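/- arXiv:0807.1009 — 2 statements merged into one kernel-verified Lean document; each statement's English description precedes it below -/
import Mathlib

section
/- Let α, β, γ, δ, κ ∈ ℂ with α ≠ 0 and (β² + γδ + ακ)² − 4ακγδ ≠ 0, and consider the matrix family A(ρ) = A₀ + ρA₁ + ρ²A₂ with A₀ = (1/2)[[α, α, 0], [α, α, 0], [0, 0, 0]], A₁ = [[β, 0, γ], [0, −β, γ], [δ/2, δ/2, 0]], A₂ = [[0,0,0],[0,0,0],[0,0,κ]]. Let μ₂, μ₃ be the two (distinct) roots of the quadratic μ² − (κ − (β² + γδ)/α)μ − β²κ/α = 0, and set μ₁ = (β² + γδ)/α. Then there exist ε > 0 and continuous functions λ₁, λ₂, λ₃ : (−ε, ε) → ℂ which for each ρ enumerate the eigenvalues of A(ρ) with multiplicity, such that λ₁(ρ) = α + ρ²μ₁ + O(ρ³), λ₂(ρ) = ρ²μ₂ + O(ρ³) and λ₃(ρ) = ρ²μ₃ + O(ρ³) as ρ → 0. -/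
open Matrix Polynomial Asymptotics Filter Topology

/-- A scalar implicit function theorem: a simple zero `y₀` of `f (t₀, ·)` extends to a `C¹` branch
of zeros of `f (t, ·)` for `t` near `t₀`. -/
theorem exists_contDiffAt_zero_branch {𝕜 : Type*} [RCLike 𝕜] {f : 𝕜 × 𝕜 → 𝕜} {t₀ y₀ d : 𝕜}
    (hf : ContDiffAt 𝕜 1 f (t₀, y₀)) (hd : HasDerivAt (fun y => f (t₀, y)) d y₀) (hd0 : d ≠ 0)
    (h0 : f (t₀, y₀) = 0) :
    ∃ y : 𝕜 → 𝕜, y t₀ = y₀ ∧ ContDiffAt 𝕜 1 y t₀ ∧ ∀ᶠ t in 𝓝 t₀, f (t, y t) = 0 := by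
  have hinr : fderiv 𝕜 f (t₀, y₀) ∘L .inr 𝕜 𝕜 𝕜 = ContinuousLinearMap.toSpanSingleton 𝕜 d :=
    ((hf.differentiableAt one_ne_zero).hasFDerivAt.comp y₀ (hasFDerivAt_prodMk_right t₀ y₀)).unique
      hd.hasFDerivAt
  have hinv : (fderiv 𝕜 f (t₀, y₀) ∘L .inr 𝕜 𝕜 𝕜).IsInvertible := by
    rw [hinr]
    refine ContinuousLinearMap.IsInvertible.of_inverse
      (g := ContinuousLinearMap.toSpanSingleton 𝕜 d⁻¹) ?_ ?_ <;>
    · ext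
      simp [hd0]
  refine ⟨hf.implicitFunction one_ne_zero hinv, hf.implicitFunction_apply_self one_ne_zero hinv,
    hf.contDiffAt_implicitFunction one_ne_zero hinv, ?_⟩
  simpa only [h0] using hf.eventually_apply_implicitFunction one_ne_zero hinv

/-- A simple root `μ` of `-a y² + b y + c` extends to a `C¹` branch of roots of
`ρ² y³ - (a + ρ² k) y² + b y + c` for real `ρ` near `0`. -/
theorem exists_contDiffAt_rescaled_root {a b c k μ : ℂ}
    (hμ : -a * μ ^ 2 + b * μ + c = 0) (hsimple : -2 * a * μ + b ≠ 0) :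
    ∃ z : ℝ → ℂ, z 0 = μ ∧ ContDiffAt ℝ 1 z 0 ∧ ∀ᶠ ρ : ℝ in 𝓝 0,
      (ρ : ℂ) ^ 2 * z ρ ^ 3 - (a + (ρ : ℂ) ^ 2 * k) * z ρ ^ 2 + b * z ρ + c = 0 := by
  obtain ⟨y, hy0, hy, hev⟩ := exists_contDiffAt_zero_branch (𝕜 := ℂ)
    (f := fun p => p.1 * p.2 ^ 3 - (a + p.1 * k) * p.2 ^ 2 + b * p.2 + c)
    (t₀ := 0) (y₀ := μ) (d := -2 * a * μ + b) (by fun_prop)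
    (by
      have h := (((hasDerivAt_id μ).pow 2).const_mul (-a)).add ((hasDerivAt_id μ).const_mul b)
      convert! h.add_const c using 1
      · ext y
        simp
      · simp
        ring)
    hsimple (by linear_combination hμ)
  have hsq : ContDiff ℝ 1 fun ρ : ℝ => (ρ : ℂ) ^ 2 := Complex.ofRealCLM.contDiff.pow 2
  have hsq0 : ((0 : ℝ) : ℂ) ^ 2 = 0 := by simp
  refine ⟨fun ρ => y ((ρ : ℂ) ^ 2), by simpa using hy0, ?_, ?_⟩
  · refine ContDiffAt.comp (0 : ℝ) (g := y) ?_ hsq.contDiffAt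
    rw [hsq0]
    exact hy.restrict_scalars ℝ
  · have ht : Tendsto (fun ρ : ℝ => (ρ : ℂ) ^ 2) (𝓝 0) (𝓝 0) := by
      simpa using hsq.continuous.tendsto 0
    exact ht.eventually hev

/-- Scaling by `ρ²` turns a first-order expansion into a third-order one. -/
theorem isBigO_sq_mul_sub_of_differentiableAt {z : ℝ → ℂ} (hz : DifferentiableAt ℝ z 0) :
    (fun ρ : ℝ => (ρ : ℂ) ^ 2 * z ρ - (ρ : ℂ) ^ 2 * z 0) =O[𝓝 0] fun ρ : ℝ => ρ ^ 3 := by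
  have h1 : (fun ρ : ℝ => z ρ - z 0) =O[𝓝 0] fun ρ : ℝ => ρ := by
    simpa using hz.hasFDerivAt.isBigO_sub
  have h2 : (fun ρ : ℝ => (ρ : ℂ) ^ 2) =O[𝓝 0] fun ρ : ℝ => ρ ^ 2 :=
    IsBigO.of_norm_le fun ρ => by simp
  refine (h2.mul h1).congr (fun ρ => ?_) fun ρ => ?_ <;> ring

/-- Eigenvalue expansions for the 3×3 example of the multi-step scheme: with `α ≠ 0` and
`(β² + γδ + ακ)² − 4ακγδ ≠ 0`, the eigenvalues of
`A(ρ) = A₀ + ρA₁ + ρ²A₂` satisfy `λ₁(ρ) = α + ρ²μ₁ + O(ρ³)`, `λ₂(ρ) = ρ²μ₂ + O(ρ³)` and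
`λ₃(ρ) = ρ²μ₃ + O(ρ³)` as `ρ → 0`, where `μ₁ = (β² + γδ)/α` and `μ₂, μ₃` are the two distinct
roots of `μ² − (κ − (β² + γδ)/α)μ − β²κ/α = 0`. -/
theorem example_eigenvalue_expansion
    (α β γ δ κ : ℂ) (hα : α ≠ 0)
    (hdisc : (β ^ 2 + γ * δ + α * κ) ^ 2 - 4 * α * κ * γ * δ ≠ 0)
    (μ₂ μ₃ : ℂ)
    (hμ₂ : μ₂ ^ 2 - (κ - (β ^ 2 + γ * δ) / α) * μ₂ - β ^ 2 * κ / α = 0)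
    (hμ₃ : μ₃ ^ 2 - (κ - (β ^ 2 + γ * δ) / α) * μ₃ - β ^ 2 * κ / α = 0)
    (hμ₂₃ : μ₂ ≠ μ₃)
    (A : ℝ → Matrix (Fin 3) (Fin 3) ℂ)
    (hA : ∀ ρ : ℝ, A ρ =
      (1 / 2 : ℂ) • !![α, α, 0; α, α, 0; 0, 0, 0] +
      (ρ : ℂ) • !![β, 0, γ; 0, -β, γ; δ / 2, δ / 2, 0] +
      ((ρ : ℂ) ^ 2) • !![0, 0, 0; 0, 0, 0; 0, 0, κ]) :
    ∃ (ε : ℝ) (lam₁ lam₂ lam₃ : ℝ → ℂ),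
      0 < ε ∧
      ContinuousOn lam₁ (Set.Ioo (-ε) ε) ∧
      ContinuousOn lam₂ (Set.Ioo (-ε) ε) ∧
      ContinuousOn lam₃ (Set.Ioo (-ε) ε) ∧
      (∀ ρ ∈ Set.Ioo (-ε) ε,
        (A ρ).charpoly =
          (Polynomial.X - Polynomial.C (lam₁ ρ)) * (Polynomial.X - Polynomial.C (lam₂ ρ)) *
            (Polynomial.X - Polynomial.C (lam₃ ρ))) ∧
      ((fun ρ : ℝ => lam₁ ρ - (α + (ρ : ℂ) ^ 2 * ((β ^ 2 + γ * δ) / α)))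
        =O[𝓝 (0 : ℝ)] fun ρ : ℝ => ρ ^ 3) ∧
      ((fun ρ : ℝ => lam₂ ρ - (ρ : ℂ) ^ 2 * μ₂) =O[𝓝 (0 : ℝ)] fun ρ : ℝ => ρ ^ 3) ∧
      ((fun ρ : ℝ => lam₃ ρ - (ρ : ℂ) ^ 2 * μ₃) =O[𝓝 (0 : ℝ)] fun ρ : ℝ => ρ ^ 3) := by
  have hαμ₂ : -α * μ₂ ^ 2 + (α * κ - β ^ 2 - γ * δ) * μ₂ + β ^ 2 * κ = 0 := by
    field_simp at hμ₂
    linear_combination -hμ₂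
  have hαμ₃ : -α * μ₃ ^ 2 + (α * κ - β ^ 2 - γ * δ) * μ₃ + β ^ 2 * κ = 0 := by
    field_simp at hμ₃
    linear_combination -hμ₃
  have hsum : α * (μ₂ + μ₃) = α * κ - β ^ 2 - γ * δ :=
    mul_left_cancel₀ (sub_ne_zero.2 hμ₂₃) (by linear_combination hαμ₃ - hαμ₂)
  have hne : α * (μ₂ - μ₃) ≠ 0 := mul_ne_zero hα (sub_ne_zero.2 hμ₂₃)
  obtain ⟨z₂, hz₂0, hz₂, hq₂⟩ := exists_contDiffAt_rescaled_root (k := κ) hαμ₂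
    (fun h => hne (by linear_combination -h - hsum))
  obtain ⟨z₃, hz₃0, hz₃, hq₃⟩ := exists_contDiffAt_rescaled_root (k := κ) hαμ₃
    (fun h => hne (by linear_combination h + hsum))
  have hO₂ := isBigO_sq_mul_sub_of_differentiableAt (hz₂.differentiableAt one_ne_zero)
  have hO₃ := isBigO_sq_mul_sub_of_differentiableAt (hz₃.differentiableAt one_ne_zero)
  rw [hz₂0] at hO₂
  rw [hz₃0] at hO₃
  have hz_ne : ∀ᶠ ρ in 𝓝 (0 : ℝ), z₂ ρ ≠ z₃ ρ :=
    (hz₂.continuousAt.ne_iff_eventually_ne hz₃.continuousAt).1 (by rwa [hz₂0, hz₃0])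
  have hc₂ := (hz₂.eventually (by simp)).mono fun _ h => h.continuousAt
  have hc₃ := (hz₃.eventually (by simp)).mono fun _ h => h.continuousAt
  obtain ⟨ε, hε, hball⟩ := Metric.eventually_nhds_iff_ball.1
    (hq₂.and (hq₃.and (hz_ne.and (hc₂.and hc₃))))
  simp only [Real.ball_eq_Ioo, zero_sub, zero_add] at hball
  have hcont₂ : ContinuousOn z₂ (Set.Ioo (-ε) ε) := fun ρ hρ =>
    (hball ρ hρ).2.2.2.1.continuousWithinAt
  have hcont₃ : ContinuousOn z₃ (Set.Ioo (-ε) ε) := fun ρ hρ =>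
    (hball ρ hρ).2.2.2.2.continuousWithinAt
  refine ⟨ε, fun ρ => α + (ρ : ℂ) ^ 2 * κ - (ρ : ℂ) ^ 2 * z₂ ρ - (ρ : ℂ) ^ 2 * z₃ ρ,
    fun ρ => (ρ : ℂ) ^ 2 * z₂ ρ, fun ρ => (ρ : ℂ) ^ 2 * z₃ ρ, hε, by fun_prop, by fun_prop,
    by fun_prop, fun ρ hρ => ?_, ?_, hO₂, hO₃⟩
  · obtain ⟨h₂, h₃, h_ne, -, -⟩ := hball ρ hρ
    have hsum_eq : (ρ : ℂ) ^ 2 * (z₂ ρ ^ 2 + z₂ ρ * z₃ ρ + z₃ ρ ^ 2)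
        - (α + (ρ : ℂ) ^ 2 * κ) * (z₂ ρ + z₃ ρ) + (α * κ - β ^ 2 - γ * δ) = 0 :=
      mul_left_cancel₀ (sub_ne_zero.2 h_ne) (by linear_combination h₂ - h₃)
    have hprod_eq : z₂ ρ * z₃ ρ * (α + (ρ : ℂ) ^ 2 * κ - (ρ : ℂ) ^ 2 * (z₂ ρ + z₃ ρ))
        = -(β ^ 2 * κ) := by
      linear_combination h₂ - z₂ ρ * hsum_eq
    refine Polynomial.funext fun x => ?_
    rw [hA, Matrix.eval_charpoly, Matrix.det_fin_three]
    simp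
    linear_combination ((ρ : ℂ) ^ 2 * x) * hsum_eq + (ρ : ℂ) ^ 4 * hprod_eq
  · refine (hO₂.add hO₃).neg_left.congr_left fun ρ => ?_
    have hμ₁ : (β ^ 2 + γ * δ) / α = κ - (μ₂ + μ₃) := by
      rw [div_eq_iff hα]
      linear_combination hsum
    rw [hμ₁]
    ring
end

section
/- Let τ, κ, γ₁, γ₂, m > 0 be real constants and consider the matrix family A(ξ) = A₀ + ξA₁ + ξ²A₂, ξ ∈ ℝ, with A₀ = (1/2)[[−m, −m, 0], [−m, −m, 0], [0, 0, 0]], A₁ = i[[τ, 0, γ₁], [0, −τ, γ₁], [γ₂/2, γ₂/2, 0]], A₂ = [[0,0,0],[0,0,0],[0,0,−κ]]. Then for every ξ ≠ 0, every eigenvalue ν of A(ξ) satisfies Re ν < 0; in particular A(ξ) has no purely imaginary eigenvalues for ξ ≠ 0. -/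
open Matrix Polynomial

/-- Routh–Hurwitz criterion for cubics: a sufficient condition for all roots of
`z³ + a z² + b z + c` to lie in the open left half-plane. -/
theorem re_neg_of_cubic_root {a b c : ℝ} (ha : 0 < a) (hb : 0 < b) (hc : 0 < c)
    (habc : c < a * b) {z : ℂ} (hz : z ^ 3 + a * z ^ 2 + b * z + c = 0) : z.re < 0 := by
  obtain ⟨x, y⟩ := z
  by_contra! hx
  replace hx : 0 ≤ x := hx
  have hre := congrArg Complex.re hz
  have him := congrArg Complex.im hz
  simp [pow_succ] at hre him
  have hy : y * (3 * x ^ 2 - y ^ 2 + 2 * a * x + b) = 0 := by linear_combination him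
  rcases mul_eq_zero.mp hy with rfl | h
  · have : 0 < x ^ 3 + a * x ^ 2 + b * x + c := by positivity
    linarith
  · have h8 : 8 * x ^ 3 + 8 * a * x ^ 2 + (2 * b + 2 * a ^ 2) * x + (a * b - c) = 0 := by
      linear_combination -hre + (3 * x + a) * h
    have : 0 ≤ 8 * x ^ 3 + 8 * a * x ^ 2 + (2 * b + 2 * a ^ 2) * x := by positivity
    linarith

/-- For the Fourier symbol of damped one-dimensional thermo-elasticity with positive constants
`τ, κ, γ₁, γ₂, m`, every eigenvalue of `A(ξ) = A₀ + ξA₁ + ξ²A₂` has strictly negative real part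
for every `ξ ≠ 0`; in particular no purely imaginary eigenvalues occur for `ξ ≠ 0`. -/
theorem thermoelastic_eigenvalues_negative_real_part
    (τ κ γ₁ γ₂ m : ℝ)
    (hτ : 0 < τ) (hκ : 0 < κ) (hγ₁ : 0 < γ₁) (hγ₂ : 0 < γ₂) (hm : 0 < m)
    (A : ℝ → Matrix (Fin 3) (Fin 3) ℂ)
    (hA : ∀ ξ : ℝ, A ξ =
      (1 / 2 : ℂ) • !![(-m : ℂ), (-m : ℂ), 0; (-m : ℂ), (-m : ℂ), 0; 0, 0, 0] +
      (ξ : ℂ) • (Complex.I •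
        !![(τ : ℂ), 0, (γ₁ : ℂ); 0, (-τ : ℂ), (γ₁ : ℂ); (γ₂ / 2 : ℂ), (γ₂ / 2 : ℂ), 0]) +
      ((ξ : ℂ) ^ 2) • !![0, 0, 0; 0, 0, 0; 0, 0, (-κ : ℂ)]) :
    ∀ ξ : ℝ, ξ ≠ 0 → ∀ ν : ℂ, (A ξ).charpoly.IsRoot ν → ν.re < 0 := by
  intro ξ hξ ν hν
  have hs : 0 < ξ ^ 2 := by positivity
  have hab : τ ^ 2 * κ * (ξ ^ 2) ^ 2 <
      (m + κ * ξ ^ 2) * ((τ ^ 2 + m * κ + γ₁ * γ₂) * ξ ^ 2) := by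
    have : 0 < m * ((τ ^ 2 + m * κ + γ₁ * γ₂) * ξ ^ 2) +
      κ * (m * κ + γ₁ * γ₂) * (ξ ^ 2) ^ 2 := by positivity
    linarith
  refine re_neg_of_cubic_root (a := m + κ * ξ ^ 2)
    (b := (τ ^ 2 + m * κ + γ₁ * γ₂) * ξ ^ 2) (c := τ ^ 2 * κ * (ξ ^ 2) ^ 2)
    (by positivity) (by positivity) (by positivity) hab ?_
  rw [IsRoot.def, eval_charpoly, hA, det_fin_three] at hν
  simp at hν
  push_cast
  ring_nf at hν ⊢
  simp only [Complex.I_sq] at hν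
  linear_combination hν
end
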